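/- arXiv:1605.09136 — 3 statements merged into one kernel-verified Lean document; each statement's English description precedes it below -/
import Mathlib

section
/- Let E be a real normed space, let (X, Y) be a random pair where X is a Bochner-integrable E-valued random element with E‖X‖² < ∞ and Y is a real random variable with E(Y²) < ∞, and let μ = E[X] denote the (Bochner) mean of X. Let f : E → ℝ be Lipschitz continuous with constant C_f and let Φ : ℝ → ℝ be Lipschitz continuous with constant C_l, with Φ(f(X)·Y) and Φ(f(μ)·Y) integrable. Then |E[Φ(f(μ)·Y)] − E[Φ(f(X)·Y)]| ≤ C_l · C_f · √(E‖X − μ‖²) · √(E(Y²)). -/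
open MeasureTheory NNReal

/-- The **Cauchy–Schwarz inequality** for nonnegative square-integrable functions. -/
theorem integral_mul_le_sqrt_mul_sqrt {Ω : Type*} [MeasurableSpace Ω] {P : Measure Ω}
    {g h : Ω → ℝ} (hg : MemLp g 2 P) (hh : MemLp h 2 P) (hg0 : 0 ≤ g) (hh0 : 0 ≤ h) :
    ∫ ω, g ω * h ω ∂P ≤ √(∫ ω, g ω ^ 2 ∂P) * √(∫ ω, h ω ^ 2 ∂P) := by
  have key := integral_mul_le_Lp_mul_Lq_of_nonneg (μ := P) Real.HolderConjugate.two_two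
    (.of_forall hg0) (.of_forall hh0) (by simpa using hg) (by simpa using hh)
  simpa only [Real.rpow_two, ← Real.sqrt_eq_rpow] using key

/-- **Theorem 1** (risk comparison between classifying on the raw random input `X` and
on its Bochner mean `μ`): if `f` is `C_f`-Lipschitz and the loss `Φ` is `C_l`-Lipschitz, then
`|E[Φ(f(μ)·Y)] − E[Φ(f(X)·Y)]| ≤ C_l · C_f · √(E‖X − μ‖²) · √(E(Y²))`. -/
theorem risk_mean_embedding_bound
    {E : Type*} [NormedAddCommGroup E] [NormedSpace ℝ E]
    {Ω : Type*} [MeasurableSpace Ω] (P : Measure Ω) [IsProbabilityMeasure P]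
    (X : Ω → E) (Y : Ω → ℝ)
    (hX : Integrable X P)
    (hX2 : Integrable (fun ω => ‖X ω‖ ^ 2) P)
    (hY2 : Integrable (fun ω => (Y ω) ^ 2) P)
    (μ : E) (hμ : μ = ∫ ω, X ω ∂P)
    (f : E → ℝ) (Φ : ℝ → ℝ) (Cf Cl : ℝ≥0)
    (hf : LipschitzWith Cf f) (hΦ : LipschitzWith Cl Φ)
    (hint1 : Integrable (fun ω => Φ (f (X ω) * Y ω)) P)
    (hint2 : Integrable (fun ω => Φ (f μ * Y ω)) P) :
    |(∫ ω, Φ (f μ * Y ω) ∂P) - ∫ ω, Φ (f (X ω) * Y ω) ∂P| ≤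
      (Cl : ℝ) * (Cf : ℝ) * Real.sqrt (∫ ω, ‖X ω - μ‖ ^ 2 ∂P) *
        Real.sqrt (∫ ω, (Y ω) ^ 2 ∂P) := by
  have hXm : MemLp (fun ω => ‖X ω - μ‖) 2 P := by
    have hX' : MemLp X 2 P := (memLp_two_iff_integrable_sq_norm hX.1).2 hX2
    exact (hX'.sub (memLp_const μ)).norm
  -- `Y` itself need not be measurable, but `|Y| = √(Y²)` is.
  have hYm : MemLp (fun ω => |Y ω|) 2 P := by
    have hmeas : AEStronglyMeasurable (fun ω => |Y ω|) P := by
      simpa only [Real.sqrt_sq_eq_abs] using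
        Real.continuous_sqrt.comp_aestronglyMeasurable hY2.1
    exact (memLp_two_iff_integrable_sq hmeas).2 (by simpa only [sq_abs] using hY2)
  have hpt (ω : Ω) : |Φ (f μ * Y ω) - Φ (f (X ω) * Y ω)| ≤
      (Cl : ℝ) * Cf * (‖X ω - μ‖ * |Y ω|) := by
    have hΦω := hΦ.dist_le_mul (f μ * Y ω) (f (X ω) * Y ω)
    have hfω := hf.dist_le_mul μ (X ω)
    rw [Real.dist_eq, Real.dist_eq, ← sub_mul, abs_mul] at hΦω
    rw [Real.dist_eq, dist_comm, dist_eq_norm] at hfω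
    calc |Φ (f μ * Y ω) - Φ (f (X ω) * Y ω)| ≤ Cl * (|f μ - f (X ω)| * |Y ω|) := hΦω
      _ ≤ Cl * (Cf * ‖X ω - μ‖ * |Y ω|) := by gcongr
      _ = Cl * Cf * (‖X ω - μ‖ * |Y ω|) := by ring
  have hCS := integral_mul_le_sqrt_mul_sqrt hXm hYm (fun _ => norm_nonneg _)
    (fun _ => abs_nonneg _)
  simp only [sq_abs] at hCS
  calc |(∫ ω, Φ (f μ * Y ω) ∂P) - ∫ ω, Φ (f (X ω) * Y ω) ∂P|
      = |∫ ω, (Φ (f μ * Y ω) - Φ (f (X ω) * Y ω)) ∂P| := by rw [integral_sub hint2 hint1]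
    _ ≤ ∫ ω, |Φ (f μ * Y ω) - Φ (f (X ω) * Y ω)| ∂P := abs_integral_le_integral_abs
    _ ≤ ∫ ω, (Cl : ℝ) * Cf * (‖X ω - μ‖ * |Y ω|) ∂P :=
        integral_mono (hint2.sub hint1).abs ((hXm.integrable_mul hYm).const_mul _) hpt
    _ = (Cl : ℝ) * Cf * ∫ ω, ‖X ω - μ‖ * |Y ω| ∂P := integral_const_mul _ _
    _ ≤ (Cl : ℝ) * Cf * (√(∫ ω, ‖X ω - μ‖ ^ 2 ∂P) * √(∫ ω, Y ω ^ 2 ∂P)) := by gcongr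
    _ = _ := by ring
end

section
/- Let E be a real normed space, let n be a positive natural number, and for each i ∈ {1, …, n} let μ_i ∈ E, μ̂_i ∈ E and y_i ∈ ℝ. Let f : E → ℝ be Lipschitz continuous with constant C_f and let Φ : ℝ → ℝ be Lipschitz continuous with constant C_l. Then |(1/n) ∑_{i=1}^n Φ(f(μ̂_i)·y_i) − (1/n) ∑_{i=1}^n Φ(f(μ_i)·y_i)| ≤ (C_l · C_f / n) · √(∑_{i=1}^n ‖μ̂_i − μ_i‖²) · √(∑_{i=1}^n y_i²). -/
open NNReal Finset

/-- **Theorem 3** (comparison of the empirical risk computed with true mean embeddings `μᵢ`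
and with their empirical estimates `μ̂ᵢ`): if `f` is `C_f`-Lipschitz and the loss `Φ` is
`C_l`-Lipschitz, then
`|(1/n) ∑ Φ(f(μ̂ᵢ)·yᵢ) − (1/n) ∑ Φ(f(μᵢ)·yᵢ)| ≤ (C_l C_f / n) √(∑‖μ̂ᵢ−μᵢ‖²) √(∑ yᵢ²)`. -/
theorem empirical_risk_mean_embedding_bound
    {E : Type*} [NormedAddCommGroup E] [NormedSpace ℝ E]
    (n : ℕ) (hn : 0 < n)
    (μ μhat : Fin n → E) (y : Fin n → ℝ)
    (f : E → ℝ) (Φ : ℝ → ℝ) (Cf Cl : ℝ≥0)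
    (hf : LipschitzWith Cf f) (hΦ : LipschitzWith Cl Φ) :
    |(1 / (n : ℝ)) * ∑ i, Φ (f (μhat i) * y i) -
        (1 / (n : ℝ)) * ∑ i, Φ (f (μ i) * y i)| ≤
      ((Cl : ℝ) * (Cf : ℝ) / (n : ℝ)) * Real.sqrt (∑ i, ‖μhat i - μ i‖ ^ 2) *
        Real.sqrt (∑ i, (y i) ^ 2) := by
  have pointwise (i : Fin n) : |Φ (f (μhat i) * y i) - Φ (f (μ i) * y i)| ≤
      Cl * Cf * (‖μhat i - μ i‖ * |y i|) := by
    calc |Φ (f (μhat i) * y i) - Φ (f (μ i) * y i)|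
        ≤ Cl * |f (μhat i) * y i - f (μ i) * y i| := by
          simpa [Real.dist_eq] using hΦ.dist_le_mul (f (μhat i) * y i) (f (μ i) * y i)
      _ = Cl * (|f (μhat i) - f (μ i)| * |y i|) := by rw [← sub_mul, abs_mul]
      _ ≤ Cl * ((Cf * ‖μhat i - μ i‖) * |y i|) := by
          gcongr
          simpa [Real.dist_eq, dist_eq_norm] using hf.dist_le_mul (μhat i) (μ i)
      _ = Cl * Cf * (‖μhat i - μ i‖ * |y i|) := by ring
  have cauchy_schwarz : ∑ i, ‖μhat i - μ i‖ * |y i| ≤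
      Real.sqrt (∑ i, ‖μhat i - μ i‖ ^ 2) * Real.sqrt (∑ i, (y i) ^ 2) := by
    simpa only [sq_abs] using
      Real.sum_mul_le_sqrt_mul_sqrt univ (fun i => ‖μhat i - μ i‖) (fun i => |y i|)
  have hn' : (0 : ℝ) ≤ 1 / n := by positivity
  rw [← mul_sub, ← sum_sub_distrib, abs_mul, abs_of_nonneg hn']
  calc 1 / (n : ℝ) * |∑ i, (Φ (f (μhat i) * y i) - Φ (f (μ i) * y i))|
      ≤ 1 / (n : ℝ) * ∑ i, Cl * Cf * (‖μhat i - μ i‖ * |y i|) := by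
        gcongr
        exact (abs_sum_le_sum_abs _ _).trans (sum_le_sum fun i _ => pointwise i)
    _ = Cl * Cf / n * ∑ i, ‖μhat i - μ i‖ * |y i| := by rw [← mul_sum]; ring
    _ ≤ Cl * Cf / n *
        (Real.sqrt (∑ i, ‖μhat i - μ i‖ ^ 2) * Real.sqrt (∑ i, (y i) ^ 2)) := by gcongr
    _ = _ := by ring
end

section
/- Let Λ be a probability measure on the Euclidean space ℝ^D, let N be a positive natural number, let Λ^N denote the N-fold product measure on (ℝ^D)^N (i.i.d. samples ω_1, …, ω_N from Λ), and let x, y ∈ ℝ^D. Then ∫ (1/N) ∑_{j=1}^N (cos(⟪ω_j, x⟫) · cos(⟪ω_j, y⟫) + sin(⟪ω_j, x⟫) · sin(⟪ω_j, y⟫)) dΛ^N(ω_1, …, ω_N) = ∫ cos(⟪ω, x − y⟫) dΛ(ω). -/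
open MeasureTheory Real RealInnerProductSpace Finset

/-- Unbiasedness of the random feature kernel estimator: sampling `ω₁, …, ω_N` i.i.d. from a
spectral probability measure `Λ` on `ℝ^D` (i.e. integrating against the `N`-fold product
measure `Λ^N`), the expectation of the random feature estimator
`(1/N) ∑ⱼ (cos⟪ωⱼ,x⟫ cos⟪ωⱼ,y⟫ + sin⟪ωⱼ,x⟫ sin⟪ωⱼ,y⟫)` equals `∫ cos⟪ω, x−y⟫ dΛ(ω)`. -/
theorem random_feature_estimator_unbiased
    {D : ℕ} (Λ : Measure (EuclideanSpace ℝ (Fin D))) [IsProbabilityMeasure Λ]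
    (N : ℕ) (hN : 0 < N)
    (x y : EuclideanSpace ℝ (Fin D)) :
    ∫ ω : Fin N → EuclideanSpace ℝ (Fin D),
        (1 / (N : ℝ)) * ∑ j, (Real.cos ⟪ω j, x⟫ * Real.cos ⟪ω j, y⟫ +
            Real.sin ⟪ω j, x⟫ * Real.sin ⟪ω j, y⟫)
        ∂(Measure.pi fun _ : Fin N => Λ) =
      ∫ ω, Real.cos ⟪ω, x - y⟫ ∂Λ := by
  simp_rw [← Real.cos_sub, ← inner_sub_right]
  set f : EuclideanSpace ℝ (Fin D) → ℝ := fun ω => Real.cos ⟪ω, x - y⟫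
  have hf : Continuous f := by fun_prop
  have hint : Integrable f Λ :=
    .of_bound hf.aestronglyMeasurable 1 (.of_forall fun ω => Real.abs_cos_le_one _)
  change ∫ ω : Fin N → EuclideanSpace ℝ (Fin D), (1 / (N : ℝ)) * ∑ j, f (ω j)
    ∂(Measure.pi fun _ : Fin N => Λ) = ∫ ω, f ω ∂Λ
  rw [integral_const_mul, integral_finsetSum _ fun j _ => integrable_comp_eval hint]
  simp_rw [integral_comp_eval (μ := fun _ : Fin N => Λ) hf.aestronglyMeasurable]
  have hN0 : (N : ℝ) ≠ 0 := by exact_mod_cast hN.ne'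
  simp [hN0]
end
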